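/- Let θ be a real number. Every connected θ-base graph is θ-elementary. -/

import Mathlib

open Polynomial

namespace MatchPoly

variable {V : Type*}

/-- The number of `r`-matchings in `G`: sets of `r` edges, no two sharing a vertex. -/
noncomputable def numMatchings (G : SimpleGraph V) (r : ℕ) : ℕ :=
  Nat.card {M : Finset (Sym2 V) // M.card = r ∧ (M : Set (Sym2 V)) ⊆ G.edgeSet ∧
    (M : Set (Sym2 V)).Pairwise fun e f => ∀ v : V, v ∈ e → v ∉ f}

/-- The matching polynomial `μ(G,x) = ∑ (-1)^r p(G,r) x^(n-2r)`. -/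
noncomputable def matchingPoly (G : SimpleGraph V) : Polynomial ℝ :=
  ∑ r ∈ Finset.range (Nat.card V + 1),
    Polynomial.C ((-1 : ℝ) ^ r * (numMatchings G r : ℝ)) *
      (Polynomial.X : Polynomial ℝ) ^ (Nat.card V - 2 * r)

/-- `mult θ G`: the multiplicity of `θ` as a root of `μ(G,x)`. -/
noncomputable def mult (θ : ℝ) (G : SimpleGraph V) : ℕ :=
  (matchingPoly G).rootMultiplicity θ

/-- `G \ X`: the induced subgraph on the complement of the vertex set `X`. -/
def deleteSet (G : SimpleGraph V) (X : Set V) : SimpleGraph ↥(Xᶜ) :=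
  G.induce (Xᶜ)

/-- `G \ v`: delete a single vertex. -/
def deleteVert (G : SimpleGraph V) (v : V) : SimpleGraph ↥({v}ᶜ : Set V) :=
  G.induce ({v}ᶜ : Set V)

/-- `u` is θ-essential: `mult(θ, G\u) = mult(θ,G) - 1`. -/
def IsEssential (θ : ℝ) (G : SimpleGraph V) (u : V) : Prop :=
  mult θ (deleteVert G u) + 1 = mult θ G

/-- `u` is θ-neutral: `mult(θ, G\u) = mult(θ,G)`. -/
def IsNeutral (θ : ℝ) (G : SimpleGraph V) (u : V) : Prop :=
  mult θ (deleteVert G u) = mult θ G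

/-- `u` is θ-positive: `mult(θ, G\u) = mult(θ,G) + 1`. -/
def IsPositive (θ : ℝ) (G : SimpleGraph V) (u : V) : Prop :=
  mult θ (deleteVert G u) = mult θ G + 1

/-- `u` is θ-special: not θ-essential but adjacent to a θ-essential vertex. -/
def IsSpecial (θ : ℝ) (G : SimpleGraph V) (u : V) : Prop :=
  ¬ IsEssential θ G u ∧ ∃ w : V, G.Adj u w ∧ IsEssential θ G w

/-- `A_θ(G)`: the set of θ-special vertices. -/
def specialSet (θ : ℝ) (G : SimpleGraph V) : Set V := {u | IsSpecial θ G u}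

/-- `N_θ(G)`: the set of θ-neutral vertices. -/
def neutralSet (θ : ℝ) (G : SimpleGraph V) : Set V := {u | IsNeutral θ G u}

/-- `P_θ(G)`: the set of θ-positive vertices that are not θ-special. -/
def positiveSet (θ : ℝ) (G : SimpleGraph V) : Set V :=
  {u | IsPositive θ G u ∧ ¬ IsSpecial θ G u}

/-- `G` is θ-super positive: `mult(θ,G) = 0` and `mult(θ,G\v) = 1` for every vertex `v`. -/
def IsSuperPositive (θ : ℝ) (G : SimpleGraph V) : Prop :=
  mult θ G = 0 ∧ ∀ v : V, mult θ (deleteVert G v) = 1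

/-- `G` is θ-elementary: θ-super positive and `P_θ(G\v) = ∅` for every vertex `v`. -/
def IsElementary (θ : ℝ) (G : SimpleGraph V) : Prop :=
  IsSuperPositive θ G ∧ ∀ v : V, positiveSet θ (deleteVert G v) = ∅

/-- `G` is θ-critical: every vertex is θ-essential and `mult(θ,G) = 1`. -/
def IsCritical (θ : ℝ) (G : SimpleGraph V) : Prop :=
  (∀ v : V, IsEssential θ G v) ∧ mult θ G = 1

/-- `c_θ(G)`: the number of θ-critical connected components of `G`. -/
noncomputable def numCritComponents (θ : ℝ) (G : SimpleGraph V) : ℕ :=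
  Nat.card {c : G.ConnectedComponent // IsCritical θ (G.induce c.supp)}

/-- `X` is a θ-barrier set: `mult(θ,G) = c_θ(G\X) - |X|`. -/
def IsBarrier (θ : ℝ) (G : SimpleGraph V) (X : Set V) : Prop :=
  numCritComponents θ (deleteSet G X) = mult θ G + X.ncard

/-- `X` is a θ-extreme set: `mult(θ,G\X) = mult(θ,G) + |X|`. -/
def IsExtreme (θ : ℝ) (G : SimpleGraph V) (X : Set V) : Prop :=
  mult θ (deleteSet G X) = mult θ G + X.ncard

/-- `G` is θ-base: θ-super positive and no θ-barrier set contains two adjacent vertices. -/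
def IsBase (θ : ℝ) (G : SimpleGraph V) : Prop :=
  IsSuperPositive θ G ∧
    ∀ X : Set V, IsBarrier θ G X → ∀ u v : V, u ∈ X → v ∈ X → ¬ G.Adj u v

section MatchSum

variable {R : Type*} [CommRing R]

/-- The matchings of `G` all of whose edges have both ends in `S`. -/
def IsMatchingOn (G : SimpleGraph V) (S : Finset V) (M : Finset (Sym2 V)) : Prop :=
  (M : Set (Sym2 V)) ⊆ G.edgeSet ∧
    (M : Set (Sym2 V)).Pairwise (fun e f => ∀ v : V, v ∈ e → v ∉ f) ∧
    ∀ e ∈ M, ∀ v ∈ e, v ∈ S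

open Classical in
/-- The matchings of `G` inside `S`, as a finset. -/
noncomputable def matchingsOn (G : SimpleGraph V) (S : Finset V) : Finset (Finset (Sym2 V)) :=
  S.sym2.powerset.filter (IsMatchingOn G S)

lemma mem_matchingsOn {G : SimpleGraph V} {S : Finset V} {M : Finset (Sym2 V)} :
    M ∈ matchingsOn G S ↔ IsMatchingOn G S M := by
  classical
  simp only [matchingsOn, Finset.mem_filter, Finset.mem_powerset, and_iff_right_iff_imp]
  intro h e he
  rw [Finset.mem_sym2_iff]
  exact h.2.2 e he

open Classical in
/-- The matching polynomial of `G` induced on `S`, with an independent weight at each vertex. -/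
noncomputable def matchSum (G : SimpleGraph V) (S : Finset V) (c : V → R) : R :=
  ∑ M ∈ matchingsOn G S, (-1) ^ M.card * ∏ v ∈ S.filter (fun v => ∀ e ∈ M, v ∉ e), c v

lemma map_matchSum {R' : Type*} [CommRing R'] (φ : R →+* R') (G : SimpleGraph V) (S : Finset V)
    (c : V → R) : φ (matchSum G S c) = matchSum G S (fun v => φ (c v)) := by
  simp [matchSum]

lemma matchSum_empty (G : SimpleGraph V) (c : V → R) : matchSum G ∅ c = 1 := by
  classical
  have : matchingsOn G ∅ = {∅} := by
    ext M
    rw [mem_matchingsOn, Finset.mem_singleton]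
    constructor
    · intro h
      rw [Finset.eq_empty_iff_forall_notMem]
      intro e he
      induction e with
      | _ a b => simpa using h.2.2 _ he a (by simp)
    · rintro rfl
      simp [IsMatchingOn]
  simp [matchSum, this]

lemma matchSum_congr (G : SimpleGraph V) {S : Finset V} {c c' : V → R}
    (h : ∀ v ∈ S, c v = c' v) : matchSum G S c = matchSum G S c' := by
  classical
  unfold matchSum
  refine Finset.sum_congr rfl fun M _ => ?_
  congr 1
  refine Finset.prod_congr rfl fun v hv => h v ?_
  simp only [Finset.mem_filter] at hv
  exact hv.1

variable [DecidableEq V]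

lemma matchSum_eq_mul_sub (G : SimpleGraph V) [DecidableRel G.Adj] {S : Finset V} {u : V}
    (hu : u ∈ S) (c : V → R) :
    matchSum G S c = c u * matchSum G (S.erase u) c -
      ∑ y ∈ (S.erase u).filter (G.Adj u), matchSum G ((S.erase u).erase y) c := by
  classical
  unfold matchSum
  rw [← Finset.sum_filter_add_sum_filter_not (matchingsOn G S) (fun M => ∀ e ∈ M, u ∉ e),
    sub_eq_add_neg]
  congr 1
  · have h1 : (matchingsOn G S).filter (fun M => ∀ e ∈ M, u ∉ e) = matchingsOn G (S.erase u) := by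
      ext M
      simp only [Finset.mem_filter, mem_matchingsOn, IsMatchingOn, Finset.mem_erase]
      constructor
      · rintro ⟨⟨h1, h2, h3⟩, h4⟩
        exact ⟨h1, h2, fun e he v hv => ⟨fun h => h4 e he (h ▸ hv), h3 e he v hv⟩⟩
      · rintro ⟨h1, h2, h3⟩
        exact ⟨⟨h1, h2, fun e he v hv => (h3 e he v hv).2⟩, fun e he hv => (h3 e he u hv).1 rfl⟩
    rw [h1, Finset.mul_sum]
    refine Finset.sum_congr rfl fun M hM => ?_
    rw [mem_matchingsOn] at hM
    have h2 : S.filter (fun v => ∀ e ∈ M, v ∉ e) =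
        insert u ((S.erase u).filter (fun v => ∀ e ∈ M, v ∉ e)) := by
      ext v
      simp only [Finset.mem_filter, Finset.mem_insert, Finset.mem_erase]
      constructor
      · rintro ⟨h, h'⟩
        by_cases hv : v = u
        · exact Or.inl hv
        · exact Or.inr ⟨⟨hv, h⟩, h'⟩
      · rintro (rfl | ⟨⟨_, h⟩, h'⟩)
        · exact ⟨hu, fun e he hv => by simpa using hM.2.2 e he _ hv⟩
        · exact ⟨h, h'⟩
    refine (congrArg ((-1) ^ M.card * ·)
      (Finset.prod_congr (s₂ := insert u ((S.erase u).filter (fun v => ∀ e ∈ M, v ∉ e)))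
        (by convert h2) fun _ _ => rfl)).trans ?_
    rw [Finset.prod_insert (by simp), mul_left_comm]
    congr!
  · rw [← Finset.sum_neg_distrib]
    simp_rw [← Finset.sum_neg_distrib]
    rw [Finset.sum_sigma']
    symm
    refine Finset.sum_bij (fun p _ => insert s(u, p.1) p.2) ?_ ?_ ?_ ?_
    · rintro ⟨y, M⟩ hp
      simp only [Finset.mem_sigma, Finset.mem_filter, Finset.mem_erase, mem_matchingsOn] at hp
      obtain ⟨⟨⟨hyu, hyS⟩, hadj⟩, h1, h2, h3⟩ := hp
      simp only [Finset.mem_filter, mem_matchingsOn]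
      have key : ∀ e ∈ M, u ∉ e ∧ y ∉ e := fun e he =>
        ⟨fun h => by simpa using h3 e he u h, fun h => by simpa using h3 e he y h⟩
      refine ⟨⟨?_, ?_, ?_⟩, ?_⟩
      · intro e he
        simp only [Finset.coe_insert, Set.mem_insert_iff] at he
        rcases he with rfl | he
        · exact hadj
        · exact h1 he
      · rw [Finset.coe_insert, Set.pairwise_insert]
        refine ⟨h2, fun e he _ => ⟨?_, ?_⟩⟩
        · intro v hv
          rw [Sym2.mem_iff] at hv
          rcases hv with rfl | rfl
          · exact (key e he).1
          · exact (key e he).2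
        · intro v hv hv'
          rw [Sym2.mem_iff] at hv'
          rcases hv' with rfl | rfl
          · exact (key e he).1 hv
          · exact (key e he).2 hv
      · intro e he v hv
        rcases Finset.mem_insert.1 he with rfl | he
        · rcases Sym2.mem_iff.1 hv with rfl | rfl
          · exact hu
          · exact hyS
        · exact Finset.mem_of_mem_erase (Finset.mem_of_mem_erase (h3 e he v hv))
      · intro h
        exact h s(u, y) (Finset.mem_insert_self _ _) (by simp)
    · rintro ⟨y, M⟩ hp ⟨y', M'⟩ hp' heq
      simp only [Finset.mem_sigma, Finset.mem_filter, Finset.mem_erase, mem_matchingsOn] at hp hp'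
      have key : ∀ e ∈ M, u ∉ e := fun e he h => by simpa using hp.2.2.2 e he u h
      have key' : ∀ e ∈ M', u ∉ e := fun e he h => by simpa using hp'.2.2.2 e he u h
      dsimp only at heq
      have hy : y = y' := by
        have : s(u, y) ∈ insert s(u, y') M' := heq ▸ Finset.mem_insert_self _ _
        rcases Finset.mem_insert.1 this with h | h
        · exact Sym2.congr_right.1 h
        · exact absurd (by simp) (key' _ h)
      subst hy
      have e1 : M = (insert s(u, y) M).erase s(u, y) :=
        (Finset.erase_insert fun h => key _ h (by simp)).symm
      have e2 : M' = (insert s(u, y) M').erase s(u, y) :=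
        (Finset.erase_insert fun h => key' _ h (by simp)).symm
      rw [e1, e2, heq]
    · intro M hM
      simp only [Finset.mem_filter, mem_matchingsOn, not_forall, not_not] at hM
      obtain ⟨⟨h1, h2, h3⟩, e, he, hue⟩ := hM
      obtain ⟨y, rfl⟩ := hue
      have hadj : G.Adj u y := h1 he
      refine ⟨⟨y, M.erase s(u, y)⟩, ?_, Finset.insert_erase he⟩
      simp only [Finset.mem_sigma, Finset.mem_filter, Finset.mem_erase, mem_matchingsOn]
      refine ⟨⟨⟨hadj.ne', h3 _ he y (by simp)⟩, hadj⟩, ?_, ?_, ?_⟩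
      · exact fun e' he' => h1 (Finset.mem_of_mem_erase he')
      · exact h2.mono (by simp)
      · intro e' he' v hv
        obtain ⟨hne, he'⟩ := Finset.mem_erase.1 he'
        have := h2 he' he hne v hv
        simp only [Sym2.mem_iff, not_or] at this
        simp [this, h3 e' he' v hv]
    · rintro ⟨y, M⟩ hp
      simp only [Finset.mem_sigma, Finset.mem_filter, Finset.mem_erase, mem_matchingsOn] at hp
      obtain ⟨⟨⟨hyu, hyS⟩, hadj⟩, h1, h2, h3⟩ := hp
      have key : ∀ e ∈ M, u ∉ e := fun e he h => by simpa using h3 e he u h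
      dsimp only
      rw [Finset.card_insert_of_notMem fun h => key _ h (by simp), pow_succ, mul_neg_one, neg_mul]
      congr 3
      ext v
      simp only [Finset.mem_filter, Finset.mem_erase, Finset.mem_insert, forall_eq_or_imp,
        Sym2.mem_iff, not_or]
      tauto

lemma matchSum_update (G : SimpleGraph V) {S : Finset V} {w : V} (hw : w ∈ S) (c : V → R) (r : R) :
    matchSum G S (Function.update c w (c w + r)) =
      matchSum G S c + r * matchSum G (S.erase w) c := by
  classical
  have h : ∀ T : Finset V, w ∉ T →
      matchSum G T (Function.update c w (c w + r)) = matchSum G T c := fun T hT =>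
    matchSum_congr G fun v hv => Function.update_of_ne (by rintro rfl; exact hT hv) _ _
  rw [matchSum_eq_mul_sub G hw, matchSum_eq_mul_sub G hw c, h _ (Finset.notMem_erase _ _),
    Finset.sum_congr rfl fun y _ => h ((S.erase w).erase y) (by simp), Function.update_self]
  ring

lemma matchSum_map {W : Type*} [DecidableEq W] {G : SimpleGraph V} {H : SimpleGraph W}
    (φ : G ↪g H) (S : Finset V) (c : W → R) :
    matchSum H (S.map φ.toEmbedding) c = matchSum G S (fun v => c (φ v)) := by
  classical
  induction S using Finset.strongInduction with
  | H S ih =>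
    rcases S.eq_empty_or_nonempty with rfl | ⟨u, hu⟩
    · simp [matchSum_empty]
    · have hu' : φ u ∈ S.map φ.toEmbedding := Finset.mem_map_of_mem _ hu
      have he : ∀ (T : Finset V) (v : V), (T.map φ.toEmbedding).erase (φ v) =
          (T.erase v).map φ.toEmbedding := fun T v => (Finset.map_erase _ _ _).symm
      rw [matchSum_eq_mul_sub H hu', matchSum_eq_mul_sub G hu, he,
        ih _ (Finset.erase_ssubset hu), Finset.filter_map, Finset.sum_map]
      congr 1
      refine Finset.sum_congr ?_ fun y hy => ?_
      · ext y
        simp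
      · have h1 := Finset.mem_of_mem_filter y hy
        rw [← ih _ ((Finset.erase_subset _ _).trans_ssubset (Finset.erase_ssubset hu)), ← he]
        exact congrArg (matchSum H · c) ((congrArg (·.erase (φ y)) (he S u)).trans (he _ y))

lemma matchSum_union (G : SimpleGraph V) {S T : Finset V} (hd : Disjoint S T)
    (hadj : ∀ a ∈ S, ∀ b ∈ T, ¬ G.Adj a b) (c : V → R) :
    matchSum G (S ∪ T) c = matchSum G S c * matchSum G T c := by
  classical
  induction S using Finset.strongInduction with
  | H S ih =>
    rcases S.eq_empty_or_nonempty with rfl | ⟨u, hu⟩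
    · simp [matchSum_empty]
    · have he : ∀ S' : Finset V, ∀ v ∈ S', S' ⊆ S → (S' ∪ T).erase v = S'.erase v ∪ T := by
        intro S' v hv hS'
        rw [Finset.erase_union_distrib,
          Finset.erase_eq_of_notMem (Finset.disjoint_left.1 hd (hS' hv))]
      have ih' : ∀ S' ⊂ S, matchSum G (S' ∪ T) c = matchSum G S' c * matchSum G T c :=
        fun S' hS' => ih S' hS' (hd.mono_left hS'.subset) fun a ha => hadj a (hS'.subset ha)
      rw [matchSum_eq_mul_sub G (Finset.mem_union_left T hu), matchSum_eq_mul_sub G hu,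
        he S u hu subset_rfl, ih' _ (Finset.erase_ssubset hu), sub_mul, mul_assoc, Finset.sum_mul]
      congr 1
      have hf : (S.erase u ∪ T).filter (G.Adj u) = (S.erase u).filter (G.Adj u) := by
        rw [Finset.filter_union, Finset.filter_false_of_mem (fun b hb => hadj u hu b hb),
          Finset.union_empty]
      rw [hf]
      refine Finset.sum_congr rfl fun y hy => ?_
      have h1 := Finset.mem_of_mem_filter y hy
      rw [he _ y h1 (Finset.erase_subset _ _),
        ih' _ ((Finset.erase_subset _ _).trans_ssubset (Finset.erase_ssubset hu))]

/-- The defect `μ(S \ u) μ(S \ v) - μ(S) μ(S \ {u, v})`; a sum of squares over paths. -/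
noncomputable def defect (G : SimpleGraph V) (S : Finset V) (u v : V) (c : V → R) : R :=
  matchSum G (S.erase u) c * matchSum G (S.erase v) c -
    matchSum G S c * matchSum G ((S.erase u).erase v) c

lemma defect_eq (G : SimpleGraph V) [DecidableRel G.Adj] {S : Finset V} {u v : V} (hu : u ∈ S)
    (hv : v ∈ S) (huv : u ≠ v) (c : V → R) :
    defect G S u v c = (if G.Adj u v then matchSum G ((S.erase u).erase v) c ^ 2 else 0) +
      ∑ y ∈ ((S.erase u).erase v).filter (G.Adj u), defect G (S.erase u) y v c := by
  have h1 := matchSum_eq_mul_sub G hu c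
  have h2 := matchSum_eq_mul_sub G (Finset.mem_erase.2 ⟨huv, hu⟩ : u ∈ S.erase v) c
  have h3 : (S.erase v).erase u = (S.erase u).erase v := Finset.erase_right_comm
  have h4 : ∀ g : V → R, ∑ y ∈ (S.erase u).filter (G.Adj u), g y =
      (if G.Adj u v then g v else 0) + ∑ y ∈ ((S.erase u).erase v).filter (G.Adj u), g y := by
    intro g
    have hv' : v ∈ S.erase u := Finset.mem_erase.2 ⟨huv.symm, hv⟩
    rw [Finset.sum_filter, Finset.sum_filter, ← Finset.add_sum_erase _ _ hv']
  rw [h3] at h2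
  rw [defect, h2, h1, h4]
  have h5 : ∑ y ∈ ((S.erase u).erase v).filter (G.Adj u), defect G (S.erase u) y v c =
      (∑ y ∈ ((S.erase u).erase v).filter (G.Adj u), matchSum G ((S.erase u).erase y) c) *
        matchSum G ((S.erase u).erase v) c - matchSum G (S.erase u) c *
      ∑ y ∈ ((S.erase u).erase v).filter (G.Adj u),
        matchSum G (((S.erase u).erase v).erase y) c := by
    rw [Finset.sum_mul, Finset.mul_sum, ← Finset.sum_sub_distrib]
    refine Finset.sum_congr rfl fun y _ => ?_
    rw [defect, Finset.erase_right_comm (a := y) (b := v)]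
  rw [h5]
  split_ifs <;> ring

lemma defect_nonneg (G : SimpleGraph V) {S : Finset V} {u v : V} (hu : u ∈ S)
    (hv : v ∈ S) (huv : u ≠ v) (c : V → ℝ) : 0 ≤ defect G S u v c := by
  classical
  induction S using Finset.strongInduction generalizing u with
  | H S ih =>
    rw [defect_eq G hu hv huv]
    refine add_nonneg (by split_ifs <;> positivity) (Finset.sum_nonneg fun y hy => ?_)
    simp only [Finset.mem_filter, Finset.mem_erase] at hy
    exact ih _ (Finset.erase_ssubset hu) (Finset.mem_erase.2 hy.1.2)
      (Finset.mem_erase.2 ⟨huv.symm, hv⟩) hy.1.1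

lemma sq_le_defect (G : SimpleGraph V) {S : Finset V} {u v : V} (hu : u ∈ S)
    (hv : v ∈ S) (huv : G.Adj u v) (c : V → ℝ) :
    matchSum G ((S.erase u).erase v) c ^ 2 ≤ defect G S u v c := by
  classical
  rw [defect_eq G hu hv huv.ne, if_pos huv]
  refine le_add_of_nonneg_right (Finset.sum_nonneg fun y hy => ?_)
  simp only [Finset.mem_filter, Finset.mem_erase] at hy
  exact defect_nonneg G (Finset.mem_erase.2 hy.1.2) (Finset.mem_erase.2 ⟨huv.ne', hv⟩) hy.1.1 c

lemma defect_erase_le (G : SimpleGraph V) {S : Finset V} {u v y : V} (hu : u ∈ S)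
    (hv : v ∈ S) (hy : y ∈ S) (huv : u ≠ v) (hyv : y ≠ v) (huy : G.Adj u y) (c : V → ℝ) :
    defect G (S.erase u) y v c ≤ defect G S u v c := by
  classical
  rw [defect_eq G hu hv huv]
  refine le_add_of_nonneg_of_le (by split_ifs <;> positivity) ?_
  refine Finset.single_le_sum (f := fun y => defect G (S.erase u) y v c) (fun z hz => ?_) ?_
  · simp only [Finset.mem_filter, Finset.mem_erase] at hz
    exact defect_nonneg G (Finset.mem_erase.2 hz.1.2) (Finset.mem_erase.2 ⟨huv.symm, hv⟩) hz.1.1 c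
  · simp [huy, huy.ne', hyv, hy]

/-- The polarization in a third vertex `w` of the defect of `u` and `v`. -/
noncomputable def crossDefect (G : SimpleGraph V) (S : Finset V) (u v w : V) (c : V → R) : R :=
  matchSum G (S.erase u) c * matchSum G ((S.erase w).erase v) c +
    matchSum G ((S.erase w).erase u) c * matchSum G (S.erase v) c -
    matchSum G S c * matchSum G (((S.erase w).erase u).erase v) c -
    matchSum G (S.erase w) c * matchSum G ((S.erase u).erase v) c

lemma defect_update (G : SimpleGraph V) {S : Finset V} {u v w : V} (hw : w ∈ S)
    (hwu : w ≠ u) (hwv : w ≠ v) (c : V → R) (r : R) :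
    defect G S u v (Function.update c w (c w + r)) =
      defect G S u v c + r * crossDefect G S u v w c + r ^ 2 * defect G (S.erase w) u v c := by
  unfold defect crossDefect
  rw [matchSum_update G hw, matchSum_update G (Finset.mem_erase.2 ⟨hwu, hw⟩),
    matchSum_update G (Finset.mem_erase.2 ⟨hwv, hw⟩),
    matchSum_update G (Finset.mem_erase.2 ⟨hwv, Finset.mem_erase.2 ⟨hwu, hw⟩⟩),
    Finset.erase_right_comm (a := u) (b := w), Finset.erase_right_comm (a := v) (b := w),
    Finset.erase_right_comm (s := S.erase u) (a := v) (b := w),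
    Finset.erase_right_comm (a := u) (b := w)]
  ring

lemma crossDefect_sq_le (G : SimpleGraph V) {S : Finset V} {u v w : V} (hu : u ∈ S)
    (hv : v ∈ S) (hw : w ∈ S) (huv : u ≠ v) (hwu : w ≠ u) (hwv : w ≠ v) (c : V → ℝ) :
    crossDefect G S u v w c ^ 2 ≤ 4 * defect G S u v c * defect G (S.erase w) u v c := by
  have h : ∀ r : ℝ, 0 ≤ defect G (S.erase w) u v c * (r * r) + crossDefect G S u v w c * r +
      defect G S u v c := by
    intro r
    have := defect_nonneg G hu hv huv (Function.update c w (c w + r))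
    rw [defect_update G hw hwu hwv] at this
    linarith
  have := discrim_le_zero h
  unfold discrim at this
  linarith

end MatchSum

section NonnegPolynomial

lemma eval_nonneg_of_sq_mul {θ : ℝ} {q : ℝ[X]} (h : ∀ x, 0 ≤ ((X - C θ) ^ 2 * q).eval x) (x : ℝ) :
    0 ≤ q.eval x := by
  have hcl : IsClosed {x : ℝ | 0 ≤ q.eval x} := isClosed_le continuous_const q.continuous
  refine closure_minimal (s := {θ}ᶜ) (fun y hy => ?_) hcl (dense_compl_singleton θ x)
  have h1 := h y
  simp only [eval_mul, eval_pow, eval_sub, eval_X, eval_C] at h1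
  exact nonneg_of_mul_nonneg_right h1 (by have := sub_ne_zero.2 hy; positivity)

lemma sq_dvd_of_nonneg {θ : ℝ} {p : ℝ[X]} (h : ∀ x, 0 ≤ p.eval x) (hd : (X - C θ) ∣ p) :
    (X - C θ) ^ 2 ∣ p := by
  obtain ⟨q, rfl⟩ := hd
  rw [pow_two]
  refine mul_dvd_mul_left _ (dvd_iff_isRoot.2 (le_antisymm ?_ ?_))
  · have hcl : IsClosed {x : ℝ | q.eval x ≤ 0} := isClosed_le q.continuous continuous_const
    refine closure_minimal (s := Set.Iio θ) (fun y hy => ?_) hcl (by simp)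
    have h1 := h y
    simp only [eval_mul, eval_sub, eval_X, eval_C] at h1
    have h2 : y < θ := hy
    change q.eval y ≤ 0
    nlinarith
  · have hcl : IsClosed {x : ℝ | 0 ≤ q.eval x} := isClosed_le continuous_const q.continuous
    refine closure_minimal (s := Set.Ioi θ) (fun y hy => ?_) hcl (by simp)
    have h1 := h y
    simp only [eval_mul, eval_sub, eval_X, eval_C] at h1
    have h2 : θ < y := hy
    change 0 ≤ q.eval y
    nlinarith

lemma pow_even_dvd_of_nonneg {θ : ℝ} {p : ℝ[X]} (h : ∀ x, 0 ≤ p.eval x) {k : ℕ}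
    (hd : (X - C θ) ^ (2 * k + 1) ∣ p) : (X - C θ) ^ (2 * k + 2) ∣ p := by
  induction k generalizing p with
  | zero => exact sq_dvd_of_nonneg h (by simpa using hd)
  | succ k ih =>
    obtain ⟨q, rfl⟩ := (pow_dvd_pow (X - C θ) (by omega : 2 ≤ 2 * (k + 1) + 1)).trans hd
    have h1 := eval_nonneg_of_sq_mul h
    have h0 : (X - C θ) ^ 2 ≠ 0 := pow_ne_zero _ (X_sub_C_ne_zero θ)
    rw [show 2 * (k + 1) + 1 = 2 + (2 * k + 1) by ring, pow_add, mul_dvd_mul_iff_left h0] at hd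
    rw [show 2 * (k + 1) + 2 = 2 + (2 * k + 2) by ring, pow_add, mul_dvd_mul_iff_left h0]
    exact ih h1 hd

lemma pow_dvd_of_le {θ : ℝ} {p q : ℝ[X]} (h : ∀ x, 0 ≤ p.eval x) (hpq : ∀ x, p.eval x ≤ q.eval x)
    {k : ℕ} (hd : (X - C θ) ^ (2 * k) ∣ q) : (X - C θ) ^ (2 * k) ∣ p := by
  induction k generalizing p q with
  | zero => simp
  | succ k ih =>
    have hq : q.eval θ = 0 := dvd_iff_isRoot.1 ((dvd_pow_self _ (by omega)).trans hd)
    have hp : (X - C θ) ∣ p := dvd_iff_isRoot.2 (le_antisymm (hq ▸ hpq θ) (h θ))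
    obtain ⟨p, rfl⟩ := sq_dvd_of_nonneg h hp
    obtain ⟨q, rfl⟩ := (pow_dvd_pow (X - C θ) (by omega : 2 ≤ 2 * (k + 1))).trans hd
    have h0 : (X - C θ) ^ 2 ≠ 0 := pow_ne_zero _ (X_sub_C_ne_zero θ)
    rw [show 2 * (k + 1) = 2 + 2 * k by ring, pow_add, mul_dvd_mul_iff_left h0] at hd ⊢
    refine ih (eval_nonneg_of_sq_mul h) (fun x => ?_) hd
    have := eval_nonneg_of_sq_mul (θ := θ) (q := q - p)
      (fun x => by rw [mul_sub, eval_sub]; exact sub_nonneg.2 (hpq x)) x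
    rwa [eval_sub, sub_nonneg] at this

end NonnegPolynomial

section Multiplicity

/-- The matching polynomial of the subgraph of `G` induced on `S`. -/
noncomputable def poly (G : SimpleGraph V) (S : Finset V) : ℝ[X] :=
  matchSum G S (fun _ => X)

/-- The multiplicity of `θ` as a root of the matching polynomial of `G` induced on `S`. -/
noncomputable def ord (θ : ℝ) (G : SimpleGraph V) (S : Finset V) : ℕ :=
  (poly G S).rootMultiplicity θ

lemma eval_matchSum_X (G : SimpleGraph V) (S : Finset V) (x : ℝ) :
    (matchSum G S (fun _ => (X : ℝ[X]))).eval x = matchSum G S (fun _ => x) := by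
  simpa using map_matchSum (evalRingHom x) G S (fun _ => (X : ℝ[X]))

variable [DecidableEq V]

lemma eval_defect_X (G : SimpleGraph V) (S : Finset V) (u v : V) (x : ℝ) :
    (defect G S u v (fun _ => (X : ℝ[X]))).eval x = defect G S u v (fun _ => x) := by
  simp [defect, eval_matchSum_X]

lemma eval_crossDefect_X (G : SimpleGraph V) (S : Finset V) (u v w : V) (x : ℝ) :
    (crossDefect G S u v w (fun _ => (X : ℝ[X]))).eval x = crossDefect G S u v w (fun _ => x) := by
  simp [crossDefect, eval_matchSum_X]

lemma poly_monic_natDegree (G : SimpleGraph V) (S : Finset V) :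
    (poly G S).Monic ∧ (poly G S).natDegree = S.card := by
  classical
  induction S using Finset.strongInduction with
  | H S ih =>
    rcases S.eq_empty_or_nonempty with rfl | ⟨u, hu⟩
    · simp [poly, matchSum_empty]
    · obtain ⟨h1, h2⟩ := ih _ (Finset.erase_ssubset hu)
      have hm : (X * poly G (S.erase u)).Monic := monic_X.mul h1
      have hc := Finset.card_erase_add_one hu
      have hn : (X * poly G (S.erase u)).natDegree = S.card := by
        rw [monic_X.natDegree_mul h1, natDegree_X, h2]
        omega
      have hd : (∑ y ∈ (S.erase u).filter (G.Adj u), poly G ((S.erase u).erase y)).degree <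
          (X * poly G (S.erase u)).degree := by
        rw [degree_eq_natDegree hm.ne_zero, hn]
        refine (degree_sum_le _ _).trans_lt ((Finset.sup_lt_iff (WithBot.bot_lt_coe _)).2 ?_)
        intro y hy
        have hy' := Finset.mem_of_mem_filter y hy
        obtain ⟨h3, h4⟩ := ih _ ((Finset.erase_subset y _).trans_ssubset (Finset.erase_ssubset hu))
        rw [degree_eq_natDegree h3.ne_zero, h4]
        have := Finset.card_erase_le (s := S.erase u) (a := y)
        exact_mod_cast (by omega : ((S.erase u).erase y).card < S.card)
      rw [poly, matchSum_eq_mul_sub G hu]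
      refine ⟨hm.sub_of_left hd, ?_⟩
      rw [← hn]
      exact natDegree_eq_of_degree_eq (degree_sub_eq_left_of_degree_lt hd)

lemma poly_ne_zero (G : SimpleGraph V) (S : Finset V) : poly G S ≠ 0 :=
  (poly_monic_natDegree G S).1.ne_zero

lemma derivative_poly (G : SimpleGraph V) (S : Finset V) :
    derivative (poly G S) = ∑ v ∈ S, poly G (S.erase v) := by
  classical
  induction S using Finset.strongInduction with
  | H S ih =>
    rcases S.eq_empty_or_nonempty with rfl | ⟨u, hu⟩
    · simp [poly, matchSum_empty]
    · have e1 : poly G S = X * poly G (S.erase u) -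
          ∑ y ∈ (S.erase u).filter (G.Adj u), poly G ((S.erase u).erase y) :=
        matchSum_eq_mul_sub G hu _
      have e2 : ∀ v ∈ S.erase u, poly G (S.erase v) = X * poly G ((S.erase u).erase v) -
          ∑ y ∈ ((S.erase u).erase v).filter (G.Adj u),
            poly G (((S.erase u).erase v).erase y) := by
        intro v hv
        have := matchSum_eq_mul_sub G (Finset.mem_erase.2
          ⟨(Finset.ne_of_mem_erase hv).symm, hu⟩ : u ∈ S.erase v) (fun _ => (X : ℝ[X]))
        rwa [Finset.erase_right_comm (a := v)] at this
      have e3 : ∑ y ∈ (S.erase u).filter (G.Adj u), derivative (poly G ((S.erase u).erase y)) =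
          ∑ v ∈ S.erase u, ∑ y ∈ ((S.erase u).erase v).filter (G.Adj u),
            poly G (((S.erase u).erase v).erase y) := by
        rw [Finset.sum_congr rfl fun y hy =>
          ih _ ((Finset.erase_subset y _).trans_ssubset (Finset.erase_ssubset hu))]
        rw [Finset.sum_comm' (t' := S.erase u)
          (s' := fun v => ((S.erase u).erase v).filter (G.Adj u))]
        · refine Finset.sum_congr rfl fun v _ => Finset.sum_congr rfl fun y _ => ?_
          rw [Finset.erase_right_comm]
        · intro x y
          simp only [Finset.mem_filter, Finset.mem_erase]
          tauto
      rw [← Finset.add_sum_erase _ _ hu, Finset.sum_congr rfl e2, Finset.sum_sub_distrib,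
        ← e3, ← Finset.mul_sum, ← ih _ (Finset.erase_ssubset hu), e1]
      simp only [derivative_sub, derivative_mul, derivative_X, one_mul, derivative_sum]
      ring

variable {θ : ℝ} {G : SimpleGraph V} {S T : Finset V} {u v w : V}

lemma pow_dvd_poly {k : ℕ} : (X - C θ) ^ k ∣ poly G S ↔ k ≤ ord θ G S :=
  (le_rootMultiplicity_iff (poly_ne_zero G S)).symm

lemma pow_dvd_poly_mul {k : ℕ} :
    (X - C θ) ^ k ∣ poly G S * poly G T ↔ k ≤ ord θ G S + ord θ G T := by
  have h := mul_ne_zero (poly_ne_zero G S) (poly_ne_zero G T)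
  rw [← le_rootMultiplicity_iff h, rootMultiplicity_mul h, ord, ord]

lemma ord_le_ord_erase_add_one (hu : u ∈ S) : ord θ G S ≤ ord θ G (S.erase u) + 1 := by
  by_contra! hlt
  set b := ord θ G (S.erase u)
  set W := derivative (poly G S) * poly G (S.erase u) -
    poly G S * derivative (poly G (S.erase u)) with hW
  have hWeq : W = poly G (S.erase u) ^ 2 +
      ∑ v ∈ S.erase u, defect G S u v (fun _ => (X : ℝ[X])) := by
    rw [hW, derivative_poly, derivative_poly, ← Finset.add_sum_erase _ _ hu, add_mul,
      Finset.sum_mul, Finset.mul_sum, add_sub_assoc, ← Finset.sum_sub_distrib, pow_two]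
    rw [add_right_inj]
    refine Finset.sum_congr rfl fun v _ => ?_
    simp only [defect, poly]
    ring
  have hle : ∀ x, (poly G (S.erase u) ^ 2).eval x ≤ W.eval x := by
    intro x
    rw [hWeq, eval_add, eval_finsetSum]
    refine le_add_of_nonneg_right (Finset.sum_nonneg fun v hv => ?_)
    rw [eval_defect_X]
    exact defect_nonneg G hu (Finset.mem_of_mem_erase hv) (Finset.ne_of_mem_erase hv).symm _
  have h0 : ∀ x, 0 ≤ (poly G (S.erase u) ^ 2).eval x := fun x => by
    rw [eval_pow]; positivity
  have hdiv : (X - C θ) ^ (2 * b + 1) ∣ W := by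
    refine dvd_sub ?_ ?_
    · rw [show 2 * b + 1 = (b + 1) + b by ring, pow_add]
      refine mul_dvd_mul ((pow_dvd_pow _ (by omega)).trans
        (pow_sub_one_dvd_derivative_of_pow_dvd (pow_dvd_poly.2 hlt))) (pow_dvd_poly.2 le_rfl)
    · refine (pow_dvd_pow _ (by omega : 2 * b + 1 ≤ (b + 2) + (b - 1))).trans ?_
      rw [pow_add]
      exact mul_dvd_mul (pow_dvd_poly.2 hlt)
        (pow_sub_one_dvd_derivative_of_pow_dvd (pow_dvd_poly.2 le_rfl))
  have := pow_dvd_of_le (k := b + 1) h0 hle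
    (pow_even_dvd_of_nonneg (fun x => (h0 x).trans (hle x)) hdiv)
  rw [pow_two, pow_dvd_poly_mul] at this
  omega

lemma ord_erase_le_ord_add_one (hu : u ∈ S) : ord θ G (S.erase u) ≤ ord θ G S + 1 := by
  classical
  have h : (X - C θ) ^ (ord θ G (S.erase u) - 1) ∣ poly G S := by
    rw [poly, matchSum_eq_mul_sub G hu]
    refine dvd_sub (Dvd.dvd.mul_left (pow_dvd_poly.2 (Nat.sub_le _ _)) _)
      (Finset.dvd_sum fun y hy => pow_dvd_poly.2 ?_)
    have := ord_le_ord_erase_add_one (θ := θ) (G := G) (Finset.mem_of_mem_filter y hy)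
    omega
  rw [pow_dvd_poly] at h
  omega

lemma exists_ord_erase_add_one_eq (h : 0 < ord θ G S) :
    ∃ v ∈ S, ord θ G (S.erase v) + 1 = ord θ G S := by
  by_contra! hne
  have hroot : (poly G S).IsRoot θ := (rootMultiplicity_pos (poly_ne_zero G S)).1 h
  have hd : (X - C θ) ^ ord θ G S ∣ derivative (poly G S) := by
    rw [derivative_poly]
    refine Finset.dvd_sum fun v hv => pow_dvd_poly.2 ?_
    have h1 := ord_le_ord_erase_add_one (θ := θ) (G := G) hv
    have h2 := hne v hv
    omega
  have h0 : derivative (poly G S) ≠ 0 := by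
    intro h0
    obtain ⟨a, ha⟩ := natDegree_eq_zero.1 (derivative_eq_zero.1 h0)
    rw [← ha, IsRoot.def, eval_C] at hroot
    exact poly_ne_zero G S (by rw [← ha, hroot, C_0])
  have h1 := (le_rootMultiplicity_iff h0).2 hd
  rw [derivative_rootMultiplicity_of_root hroot] at h1
  unfold ord at h h1
  omega

lemma pow_dvd_defect {k : ℕ} (h1 : k ≤ ord θ G (S.erase u) + ord θ G (S.erase v))
    (h2 : k ≤ ord θ G S + ord θ G ((S.erase u).erase v)) :
    (X - C θ) ^ k ∣ defect G S u v (fun _ => (X : ℝ[X])) :=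
  dvd_sub (pow_dvd_poly_mul.2 h1) (pow_dvd_poly_mul.2 h2)

lemma defect_X_nonneg (hu : u ∈ S) (hv : v ∈ S) (huv : u ≠ v) (x : ℝ) :
    0 ≤ (defect G S u v (fun _ => (X : ℝ[X]))).eval x := by
  rw [eval_defect_X]
  exact defect_nonneg G hu hv huv _

/-- An odd vanishing order of the defect is impossible. -/
lemma pow_succ_dvd_defect {k : ℕ} (hu : u ∈ S) (hv : v ∈ S) (huv : u ≠ v) (hk : Odd k)
    (h1 : k ≤ ord θ G (S.erase u) + ord θ G (S.erase v))
    (h2 : k ≤ ord θ G S + ord θ G ((S.erase u).erase v)) :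
    (X - C θ) ^ (k + 1) ∣ defect G S u v (fun _ => (X : ℝ[X])) := by
  obtain ⟨k, rfl⟩ := hk
  exact pow_even_dvd_of_nonneg (defect_X_nonneg hu hv huv) (pow_dvd_defect h1 h2)

lemma even_of_lt_right (hu : u ∈ S) (hv : v ∈ S) (huv : u ≠ v)
    (h : ord θ G (S.erase u) + ord θ G (S.erase v) <
      ord θ G S + ord θ G ((S.erase u).erase v)) :
    Even (ord θ G (S.erase u) + ord θ G (S.erase v)) := by
  by_contra hodd
  have h1 := pow_succ_dvd_defect (θ := θ) hu hv huv (Nat.not_even_iff_odd.1 hodd) le_rfl h.le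
  have h2 := (dvd_sub_left (pow_dvd_poly_mul.2 h)).1 h1
  exact absurd (pow_dvd_poly_mul.1 h2) (by omega)

lemma even_of_lt_left (hu : u ∈ S) (hv : v ∈ S) (huv : u ≠ v)
    (h : ord θ G S + ord θ G ((S.erase u).erase v) <
      ord θ G (S.erase u) + ord θ G (S.erase v)) :
    Even (ord θ G S + ord θ G ((S.erase u).erase v)) := by
  by_contra hodd
  have h1 := pow_succ_dvd_defect (θ := θ) hu hv huv (Nat.not_even_iff_odd.1 hodd) h.le le_rfl
  have h2 := (dvd_sub_right (pow_dvd_poly_mul.2 h)).1 h1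
  exact absurd (pow_dvd_poly_mul.1 h2) (by omega)

lemma le_two_mul_ord_of_adj {k : ℕ} (hu : u ∈ S) (hv : v ∈ S) (huv : G.Adj u v)
    (h1 : k ≤ ord θ G (S.erase u) + ord θ G (S.erase v))
    (h2 : k ≤ ord θ G S + ord θ G ((S.erase u).erase v)) :
    k ≤ 2 * ord θ G ((S.erase u).erase v) := by
  have key : ∀ j, (X - C θ) ^ (2 * j) ∣ defect G S u v (fun _ => (X : ℝ[X])) →
      2 * j ≤ 2 * ord θ G ((S.erase u).erase v) := by
    intro j hj
    have := pow_dvd_of_le (p := poly G ((S.erase u).erase v) ^ 2)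
      (fun x => by rw [eval_pow]; positivity) (fun x => ?_) hj
    · rw [pow_two, pow_dvd_poly_mul] at this
      omega
    · rw [eval_defect_X, eval_pow, poly, eval_matchSum_X]
      exact sq_le_defect G hu hv huv _
  rcases Nat.even_or_odd k with hk | hk
  · obtain ⟨j, rfl⟩ := hk
    have := key j (by rw [two_mul]; exact pow_dvd_defect h1 h2)
    omega
  · have h3 := pow_succ_dvd_defect (θ := θ) hu hv huv.ne hk h1 h2
    obtain ⟨j, rfl⟩ := hk
    have := key (j + 1) h3
    omega

lemma pow_dvd_defect_erase {k : ℕ} {y : V} (hu : u ∈ S) (hv : v ∈ S) (hy : y ∈ S) (huv : u ≠ v)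
    (hyv : y ≠ v) (huy : G.Adj u y)
    (h1 : 2 * k ≤ ord θ G (S.erase u) + ord θ G (S.erase v))
    (h2 : 2 * k ≤ ord θ G S + ord θ G ((S.erase u).erase v)) :
    (X - C θ) ^ (2 * k) ∣ defect G (S.erase u) y v (fun _ => (X : ℝ[X])) := by
  refine pow_dvd_of_le (defect_X_nonneg (Finset.mem_erase.2 ⟨huy.ne', hy⟩)
    (Finset.mem_erase.2 ⟨huv.symm, hv⟩) hyv) (fun x => ?_) (pow_dvd_defect h1 h2)
  rw [eval_defect_X, eval_defect_X]
  exact defect_erase_le G hu hv hy huv hyv huy _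

lemma pow_dvd_crossDefect {k : ℕ} (hu : u ∈ S) (hv : v ∈ S) (hw : w ∈ S) (huv : u ≠ v)
    (hwu : w ≠ u) (hwv : w ≠ v)
    (h1 : 2 * k ≤ ord θ G (S.erase u) + ord θ G (S.erase v))
    (h2 : 2 * k ≤ ord θ G S + ord θ G ((S.erase u).erase v))
    (h3 : 2 * k ≤ ord θ G ((S.erase w).erase u) + ord θ G ((S.erase w).erase v))
    (h4 : 2 * k ≤ ord θ G (S.erase w) + ord θ G (((S.erase w).erase u).erase v)) :
    (X - C θ) ^ (2 * k) ∣ crossDefect G S u v w (fun _ => (X : ℝ[X])) := by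
  have hd : (X - C θ) ^ (2 * (2 * k)) ∣ 4 * defect G S u v (fun _ => (X : ℝ[X])) *
      defect G (S.erase w) u v (fun _ => (X : ℝ[X])) := by
    rw [show 2 * (2 * k) = 2 * k + 2 * k by ring, pow_add]
    exact mul_dvd_mul (Dvd.dvd.mul_left (pow_dvd_defect h1 h2) _) (pow_dvd_defect h3 h4)
  have := pow_dvd_of_le (p := crossDefect G S u v w (fun _ => (X : ℝ[X])) ^ 2)
    (fun x => by rw [eval_pow]; positivity) (fun x => ?_) hd
  · rw [mul_comm 2, pow_mul, IsIntegrallyClosed.pow_dvd_pow_iff two_ne_zero] at this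
    exact this
  · simp only [eval_pow, eval_mul, eval_crossDefect_X, eval_defect_X, eval_ofNat]
    exact crossDefect_sq_le G hu hv hw huv hwu hwv _

/-- A nonessential neighbour of an essential vertex is positive. -/
lemma ord_erase_of_special {e z : V} (he : e ∈ S) (hz : z ∈ S) (hadj : G.Adj z e)
    (hess : ord θ G (S.erase e) + 1 = ord θ G S) (hnot : ord θ G (S.erase z) + 1 ≠ ord θ G S) :
    ord θ G (S.erase z) = ord θ G S + 1 := by
  have hez : e ∈ S.erase z := Finset.mem_erase.2 ⟨hadj.ne', he⟩
  have h1 := ord_le_ord_erase_add_one (θ := θ) (G := G) hz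
  have h2 := ord_erase_le_ord_add_one (θ := θ) (G := G) hz
  have h3 := ord_le_ord_erase_add_one (θ := θ) (G := G) hez
  by_contra hne
  have h5 := le_two_mul_ord_of_adj (θ := θ) (k := 2 * ord θ G S - 1) hz he hadj
    (by omega) (by omega)
  have h6 := even_of_lt_right (θ := θ) (G := G) hz he hadj.ne (by omega)
  rw [Nat.even_iff] at h6
  omega

/-- Deleting a special vertex keeps the other positive vertices positive. -/
lemma ord_erase_erase_of_special {e z : V} (he : e ∈ S) (hz : z ∈ S) (hw : w ∈ S)
    (hadj : G.Adj z e) (hzw : z ≠ w) (hess : ord θ G (S.erase e) + 1 = ord θ G S)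
    (hzpos : ord θ G (S.erase z) = ord θ G S + 1) (hwpos : ord θ G (S.erase w) = ord θ G S + 1) :
    ord θ G ((S.erase z).erase w) = ord θ G S + 2 := by
  have hew : e ≠ w := by
    rintro rfl
    omega
  have hze : z ≠ e := hadj.ne
  have mem : ∀ {a b : V}, a ∈ S → a ≠ b → a ∈ S.erase b := fun h h' =>
    Finset.mem_erase.2 ⟨h', h⟩
  have c1 : (S.erase z).erase e = (S.erase e).erase z := Finset.erase_right_comm
  have c2 : (S.erase w).erase e = (S.erase e).erase w := Finset.erase_right_comm
  have c3 : ((S.erase z).erase w).erase e = ((S.erase e).erase z).erase w := by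
    rw [Finset.erase_right_comm (a := w), c1]
  have c4 : ((S.erase z).erase e).erase w = ((S.erase e).erase z).erase w := by rw [c1]
  have hezw : e ∈ (S.erase z).erase w := Finset.mem_erase.2 ⟨hew, mem he hze.symm⟩
  have b1 := ord_le_ord_erase_add_one (θ := θ) (G := G) (mem hw hzw.symm)
  have b2 := ord_erase_le_ord_add_one (θ := θ) (G := G) (mem hw hzw.symm)
  have b3 := ord_erase_le_ord_add_one (θ := θ) (G := G) (mem hz hze)
  have b4 := ord_le_ord_erase_add_one (θ := θ) (G := G) (mem he hze.symm)
  have b5 := ord_erase_le_ord_add_one (θ := θ) (G := G) (mem hw hew.symm)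
  have b6 := ord_le_ord_erase_add_one (θ := θ) (G := G) (mem he hew)
  have b7 := ord_le_ord_erase_add_one (θ := θ) (G := G) hezw
  have b8 := ord_erase_le_ord_add_one (θ := θ) (G := G) hezw
  rw [c3] at b7 b8
  rw [c1] at b4
  rw [c2] at b6
  by_contra hne
  have hm : ord θ G ((S.erase z).erase w) = ord θ G S := by
    by_contra hne'
    have := even_of_lt_left (θ := θ) (G := G) hz hw hzw (by omega)
    rw [Nat.even_iff] at this
    omega
  have hcase : ord θ G (((S.erase e).erase z).erase w) + 1 = ord θ G S ∨
      ord θ G (((S.erase e).erase z).erase w) = ord θ G S ∨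
      ord θ G (((S.erase e).erase z).erase w) = ord θ G S + 1 := by omega
  rcases hcase with h | h | h
  · have h1 := pow_dvd_defect_erase (θ := θ) (k := ord θ G S) he hw hz hew hzw hadj.symm
      (by omega) (by omega)
    have h2 := (dvd_sub_right (pow_dvd_poly_mul.2 (by omega))).1 h1
    have h3 := pow_dvd_poly_mul.1 h2
    omega
  · have := even_of_lt_left (θ := θ) (G := G) (mem hz hze) (mem hw hew.symm) hzw (by omega)
    rw [Nat.even_iff] at this
    omega
  · have h1 := pow_dvd_crossDefect (θ := θ) (G := G) (k := ord θ G S) he hw hz hew hze hzw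
      (by omega) (by omega) (by rw [c1]; omega) (by rw [c4]; omega)
    have h2 := (dvd_sub_left (pow_dvd_poly_mul.2 (by omega))).1 h1
    have h3 := (dvd_sub_left (pow_dvd_poly_mul.2 (by rw [c4]; omega))).1 h2
    have h4 := (dvd_add_left (pow_dvd_poly_mul.2 (by rw [c1]; omega))).1 h3
    have h5 := pow_dvd_poly_mul.1 h4
    omega

/-- For essential vertices, failing to lower the multiplicity by two is transitive. -/
lemma ord_erase_erase_trans (hu : u ∈ S) (hv : v ∈ S) (hw : w ∈ S) (huv : u ≠ v) (hwu : w ≠ u)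
    (hwv : w ≠ v) (hess : ∀ v ∈ S, ord θ G (S.erase v) + 1 = ord θ G S)
    (h1 : ord θ G S ≤ ord θ G ((S.erase u).erase w) + 1)
    (h2 : ord θ G S ≤ ord θ G ((S.erase w).erase v) + 1) :
    ord θ G S ≤ ord θ G ((S.erase u).erase v) + 1 := by
  have mem : ∀ {a b : V}, a ∈ S → a ≠ b → a ∈ S.erase b := fun h h' =>
    Finset.mem_erase.2 ⟨h', h⟩
  have c1 : (S.erase u).erase w = (S.erase w).erase u := Finset.erase_right_comm
  have c2 : ((S.erase u).erase v).erase w = ((S.erase w).erase u).erase v := by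
    rw [Finset.erase_right_comm (a := v), c1]
  rw [c1] at h1
  have eu := hess u hu
  have ev := hess v hv
  have ew := hess w hw
  have hw' : w ∈ (S.erase u).erase v := Finset.mem_erase.2 ⟨hwv, mem hw hwu⟩
  have hv' : v ∈ (S.erase w).erase u := Finset.mem_erase.2 ⟨huv.symm, mem hv hwv.symm⟩
  have b1 := ord_le_ord_erase_add_one (θ := θ) (G := G) (mem hv huv.symm)
  have b2 := ord_erase_le_ord_add_one (θ := θ) (G := G) hw'
  have b3 := ord_le_ord_erase_add_one (θ := θ) (G := G) hv'
  rw [c2] at b2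
  by_contra! hlt
  have hcase : ord θ G (((S.erase w).erase u).erase v) + 2 = ord θ G S ∨
      ord θ G (((S.erase w).erase u).erase v) + 1 = ord θ G S := by omega
  rcases hcase with h | h
  · have := even_of_lt_left (θ := θ) (G := G) (mem hu hwu.symm) (mem hv hwv.symm) huv (by omega)
    rw [Nat.even_iff] at this
    omega
  · have h3 := pow_dvd_crossDefect (θ := θ) (G := G) (k := ord θ G S - 1) hu hv hw huv hwu hwv
      (by omega) (by omega) (by omega) (by omega)
    have h4 := (dvd_sub_right (dvd_sub (dvd_add (pow_dvd_poly_mul.2 (by omega))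
      (pow_dvd_poly_mul.2 (by omega))) (pow_dvd_poly_mul.2 (by omega)))).1 h3
    have h5 := pow_dvd_poly_mul.1 h4
    omega

end Multiplicity

section Link

lemma card_uncovered [Fintype V] [DecidableEq V] {G : SimpleGraph V} {M : Finset (Sym2 V)}
    (hM : IsMatchingOn G Finset.univ M) :
    (Finset.univ.filter (fun v => ∀ e ∈ M, v ∉ e)).card + 2 * M.card = Fintype.card V := by
  have h1 : Finset.univ.filter (fun v => ¬ ∀ e ∈ M, v ∉ e) = M.biUnion Sym2.toFinset := by
    ext v
    simp
  have h2 : (M.biUnion Sym2.toFinset).card = 2 * M.card := by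
    rw [Finset.card_biUnion, Finset.sum_congr rfl fun e he =>
      Sym2.card_toFinset_of_not_isDiag e (G.not_isDiag_of_mem_edgeSet (hM.1 he))]
    · rw [Finset.sum_const, smul_eq_mul, mul_comm]
    · intro e he f hf hef
      change Disjoint e.toFinset f.toFinset
      rw [Finset.disjoint_left]
      intro v hv hv'
      exact hM.2.1 he hf hef v (Sym2.mem_toFinset.1 hv) (Sym2.mem_toFinset.1 hv')
  rw [← h2, ← h1, Finset.card_filter_add_card_filter_not]
  exact Finset.card_univ

lemma matchingPoly_eq_poly [Fintype V] (G : SimpleGraph V) :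
    matchingPoly G = poly G Finset.univ := by
  classical
  have key : ∀ M ∈ matchingsOn G Finset.univ,
      (Finset.univ.filter (fun v => ∀ e ∈ M, v ∉ e)).card + 2 * M.card = Nat.card V := fun M hM =>
    (card_uncovered (mem_matchingsOn.1 hM)).trans Nat.card_eq_fintype_card.symm
  have hmaps : ∀ M ∈ matchingsOn G Finset.univ, M.card ∈ Finset.range (Nat.card V + 1) := by
    intro M hM
    have := key M hM
    rw [Finset.mem_range]
    omega
  rw [matchingPoly, poly, matchSum, ← Finset.sum_fiberwise_of_maps_to hmaps]
  refine Finset.sum_congr rfl fun r _ => ?_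
  have hnum : numMatchings G r = ((matchingsOn G Finset.univ).filter (·.card = r)).card := by
    refine Nat.subtype_card _ fun M => ?_
    simp only [Finset.mem_filter, mem_matchingsOn, IsMatchingOn, Finset.mem_univ, implies_true,
      and_true]
    tauto
  have hterm : ∀ M ∈ (matchingsOn G Finset.univ).filter (·.card = r),
      (-1) ^ M.card * ∏ v ∈ Finset.univ.filter (fun v => ∀ e ∈ M, v ∉ e), (X : ℝ[X]) =
        (-1) ^ r * X ^ (Nat.card V - 2 * r) := by
    intro M hM
    obtain ⟨hM', rfl⟩ := Finset.mem_filter.1 hM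
    rw [Finset.prod_const, ← key M hM', Nat.add_sub_cancel]
  rw [hnum]
  refine Eq.trans ?_ (Finset.sum_congr rfl
    (g := fun _ => (-1) ^ r * X ^ (Nat.card V - 2 * r)) fun M hM => by convert hterm M hM).symm
  rw [Finset.sum_const, nsmul_eq_mul]
  simp only [map_mul, map_pow, map_neg, map_one, map_natCast]
  ring

lemma mult_eq_ord {W : Type*} [Finite W] [DecidableEq V] (θ : ℝ) {H : SimpleGraph W}
    {G : SimpleGraph V} (φ : H ↪g G) {S : Finset V} (hS : ∀ x, x ∈ S ↔ ∃ y, φ y = x) :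
    mult θ H = ord θ G S := by
  classical
  have := Fintype.ofFinite W
  have h : S = Finset.univ.map φ.toEmbedding := by
    ext x
    simp [hS]
  rw [mult, ord, matchingPoly_eq_poly, h, poly, poly, matchSum_map]

lemma mult_eq_ord_univ [Fintype V] [DecidableEq V] (θ : ℝ) (G : SimpleGraph V) :
    mult θ G = ord θ G Finset.univ := by
  rw [mult, ord, matchingPoly_eq_poly]

lemma mult_deleteVert [Fintype V] [DecidableEq V] (θ : ℝ) (G : SimpleGraph V) (v : V) :
    mult θ (deleteVert G v) = ord θ G (Finset.univ.erase v) :=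
  mult_eq_ord θ (SimpleGraph.Embedding.induce _) fun x => by simp

lemma mult_deleteSet [Fintype V] [DecidableEq V] (θ : ℝ) (G : SimpleGraph V) (Y : Finset V) :
    mult θ (deleteSet G (Y : Set V)) = ord θ G Yᶜ :=
  mult_eq_ord θ (SimpleGraph.Embedding.induce _) fun x => by simp

lemma mult_induce [DecidableEq V] [Finite V] (θ : ℝ) (G : SimpleGraph V) {s : Set V} {S : Finset V}
    (hS : ∀ x, x ∈ S ↔ x ∈ s) : mult θ (G.induce s) = ord θ G S :=
  mult_eq_ord θ (SimpleGraph.Embedding.induce _) fun x => by simp [hS]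

lemma mult_induce_deleteVert [DecidableEq V] [Finite V] (θ : ℝ) (G : SimpleGraph V) {s : Set V}
    {S : Finset V} (hS : ∀ x, x ∈ S ↔ x ∈ s) (v : s) :
    mult θ (deleteVert (G.induce s) v) = ord θ G (S.erase v) := by
  refine mult_eq_ord θ
    ((SimpleGraph.Embedding.induce _).trans (SimpleGraph.Embedding.induce _)) fun x => ?_
  rw [Finset.mem_erase, hS]
  constructor
  · exact fun h => ⟨⟨⟨x, h.2⟩, fun hx => h.1 (congrArg Subtype.val hx)⟩, rfl⟩
  · rintro ⟨⟨⟨a, ha⟩, hb⟩, rfl⟩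
    exact ⟨fun hx => hb (Subtype.ext hx), ha⟩

lemma mult_deleteVert_deleteVert [Fintype V] [DecidableEq V] (θ : ℝ) (G : SimpleGraph V) (v : V)
    (w : ↥({v}ᶜ : Set V)) :
    mult θ (deleteVert (deleteVert G v) w) = ord θ G ((Finset.univ.erase v).erase w) :=
  mult_induce_deleteVert θ G (fun x => by simp) w

lemma mult_deleteSet_deleteVert [Fintype V] [DecidableEq V] (θ : ℝ) (G : SimpleGraph V)
    (Y : Finset V) (w : ↥((Y : Set V)ᶜ)) :
    mult θ (deleteVert (deleteSet G (Y : Set V)) w) = ord θ G (Yᶜ.erase w) :=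
  mult_induce_deleteVert θ G (fun x => by simp) w

end Link

section Components

variable [DecidableEq V] {θ : ℝ} {G : SimpleGraph V} {S T : Finset V}

lemma ord_union (hd : Disjoint S T) (hadj : ∀ a ∈ S, ∀ b ∈ T, ¬ G.Adj a b) :
    ord θ G (S ∪ T) = ord θ G S + ord θ G T := by
  have h : poly G (S ∪ T) = poly G S * poly G T := matchSum_union G hd hadj _
  rw [ord, h, rootMultiplicity_mul (mul_ne_zero (poly_ne_zero G S) (poly_ne_zero G T)), ord, ord]

/-- Gallai's lemma: a connected set whose vertices are all essential has multiplicity one. -/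
lemma ord_eq_one_of_essential (hcl : ∀ x ∈ S, ∀ y, G.Adj x y → y ∈ S)
    (hconn : ∀ x ∈ S, ∀ y ∈ S, G.Reachable x y) (hne : S.Nonempty)
    (hess : ∀ v ∈ S, ord θ G (S.erase v) + 1 = ord θ G S) : ord θ G S = 1 := by
  obtain ⟨u, hu⟩ := hne
  have eu := hess u hu
  by_contra hm
  obtain ⟨v, hv, hvu⟩ := exists_ord_erase_add_one_eq (θ := θ) (G := G) (S := S.erase u) (by omega)
  have hadj : ∀ x ∈ S, ∀ y ∈ S, G.Adj x y → ord θ G S ≤ ord θ G ((S.erase x).erase y) + 1 := by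
    intro x hx y hy hxy
    have h1 := ord_le_ord_erase_add_one (θ := θ) (G := G) (Finset.mem_erase.2 ⟨hxy.ne', hy⟩)
    have ex := hess x hx
    have ey := hess y hy
    have := le_two_mul_ord_of_adj (θ := θ) (k := 2 * ord θ G S - 2) hx hy hxy
      (by omega) (by omega)
    omega
  have key : v ∈ S ∧ (v = u ∨ ord θ G S ≤ ord θ G ((S.erase u).erase v) + 1) := by
    have hr := (SimpleGraph.reachable_iff_reflTransGen u v).1
      (hconn u hu v (Finset.mem_of_mem_erase hv))
    clear hv hvu
    induction hr with
    | refl => exact ⟨hu, Or.inl rfl⟩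
    | @tail x y _ hxy ih =>
      obtain ⟨hx, h⟩ := ih
      have hy := hcl x hx y hxy
      refine ⟨hy, ?_⟩
      by_cases hyu : y = u
      · exact Or.inl hyu
      · right
        by_cases hxu : x = u
        · subst hxu
          exact hadj _ hx _ hy hxy
        · exact ord_erase_erase_trans hu hy hx (Ne.symm hyu) hxu hxy.ne hess
            (h.resolve_left hxu) (hadj x hx y hy hxy)
  rcases key.2 with h | h
  · exact Finset.ne_of_mem_erase hv h
  · omega

open Classical in
/-- If no vertex is positive, the multiplicity counts the critical components. -/
lemma numCritComponents_eq_ord [Fintype V]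
    (h : ∀ v, ord θ G (Finset.univ.erase v) ≤ ord θ G Finset.univ) :
    numCritComponents θ G = ord θ G Finset.univ := by
  let K : G.ConnectedComponent → Finset V := fun c => Finset.univ.filter (· ∈ c.supp)
  have hK : ∀ c x, x ∈ K c ↔ x ∈ c.supp := fun c x => by simp [K]
  have hcl : ∀ c, ∀ x ∈ K c, ∀ y, G.Adj x y → y ∈ K c := by
    intro c x hx y hxy
    rw [hK, SimpleGraph.ConnectedComponent.mem_supp_iff] at hx ⊢
    rw [← hx]
    exact (SimpleGraph.ConnectedComponent.connectedComponentMk_eq_of_adj hxy).symm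
  have hconn : ∀ c, ∀ x ∈ K c, ∀ y ∈ K c, G.Reachable x y := by
    intro c x hx y hy
    rw [hK, SimpleGraph.ConnectedComponent.mem_supp_iff] at hx hy
    exact SimpleGraph.ConnectedComponent.exact (hx.trans hy.symm)
  have hKne : ∀ c, (K c).Nonempty := fun c => by
    obtain ⟨x, hx⟩ := c.nonempty_supp
    exact ⟨x, (hK c x).2 hx⟩
  have hsplit : ∀ c, ∀ S ⊆ K c, ord θ G (S ∪ (K c)ᶜ) = ord θ G S + ord θ G (K c)ᶜ := by
    intro c S hS
    refine ord_union ?_ ?_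
    · rw [Finset.disjoint_left]
      exact fun a ha hb => (Finset.mem_compl.1 hb) (hS ha)
    · exact fun a ha b hb hab => (Finset.mem_compl.1 hb) (hcl c a (hS ha) b hab)
  have hnonpos : ∀ c, ∀ v ∈ K c, ord θ G ((K c).erase v) ≤ ord θ G (K c) := by
    intro c v hv
    have h1 := hsplit c (K c) subset_rfl
    have h2 := hsplit c ((K c).erase v) (Finset.erase_subset _ _)
    have h3 : (K c).erase v ∪ (K c)ᶜ = Finset.univ.erase v := by
      ext x
      simp only [Finset.mem_union, Finset.mem_erase, Finset.mem_compl, Finset.mem_univ, and_true]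
      constructor
      · rintro (h | h)
        · exact h.1
        · rintro rfl
          exact h hv
      · intro h
        by_cases hx : x ∈ K c
        · exact Or.inl ⟨h, hx⟩
        · exact Or.inr hx
    rw [Finset.union_compl] at h1
    rw [h3] at h2
    have := h v
    omega
  have hcrit : ∀ c : G.ConnectedComponent, ord θ G (K c) =
      if IsCritical θ (G.induce c.supp) then 1 else 0 := by
    intro c
    split_ifs with hc
    · rw [← mult_induce θ G (hK c)]
      exact hc.2
    · by_contra hpos
      obtain ⟨u, hu, huess⟩ := exists_ord_erase_add_one_eq (Nat.pos_of_ne_zero hpos)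
      have hess : ∀ v ∈ K c, ord θ G ((K c).erase v) + 1 = ord θ G (K c) := by
        intro v hv
        have hr := (SimpleGraph.reachable_iff_reflTransGen u v).1 (hconn c u hu v hv)
        clear hv
        suffices h : v ∈ K c ∧ ord θ G ((K c).erase v) + 1 = ord θ G (K c) from h.2
        induction hr with
        | refl => exact ⟨hu, huess⟩
        | @tail x y _ hxy ih =>
          have hy := hcl c x ih.1 y hxy
          refine ⟨hy, ?_⟩
          by_contra hne
          have h1 := ord_erase_of_special ih.1 hy hxy.symm ih.2 hne
          have h2 := hnonpos c y hy
          omega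
      have h1 := ord_eq_one_of_essential (hcl c) (hconn c) (hKne c) hess
      refine hc ⟨fun v => ?_, by rw [mult_induce θ G (hK c), h1]⟩
      rw [IsEssential, mult_induce_deleteVert θ G (hK c), mult_induce θ G (hK c)]
      exact hess v ((hK c v).2 v.2)
  have hsum : ∀ C : Finset G.ConnectedComponent, ord θ G (C.biUnion K) = ∑ c ∈ C, ord θ G (K c) := by
    intro C
    induction C using Finset.induction_on with
    | empty => simp [ord, poly, matchSum_empty]
    | insert c C hc ih =>
      rw [Finset.biUnion_insert, Finset.sum_insert hc, ← ih]
      have hdis : ∀ a ∈ K c, a ∉ C.biUnion K := by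
        intro a ha hb
        obtain ⟨d, hd, had⟩ := Finset.mem_biUnion.1 hb
        rw [hK, SimpleGraph.ConnectedComponent.mem_supp_iff] at ha had
        exact hc (ha ▸ had ▸ hd)
      refine ord_union (Finset.disjoint_left.2 hdis) ?_
      exact fun a ha b hb hab => hdis b (hcl c a ha b hab) hb
  have huniv : Finset.univ.biUnion K = (Finset.univ : Finset V) := by
    ext x
    simp [hK]
  rw [← huniv, hsum, Finset.sum_congr rfl fun c _ => hcrit c, numCritComponents,
    Nat.card_eq_fintype_card, Fintype.card_subtype, Finset.card_filter]

end Components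

section Main

variable [Fintype V] [DecidableEq V] {θ : ℝ} {G : SimpleGraph V}

/-- A set whose deletion raises the multiplicity of a base graph by its size is
contained in a barrier, hence independent. -/
lemma not_adj_of_extreme (hbase : IsBase θ G) {Y : Finset V} (hY : ord θ G Yᶜ = Y.card) {u v : V}
    (hu : u ∈ Y) (hv : v ∈ Y) : ¬ G.Adj u v := by
  obtain ⟨Z, hZ, hmax⟩ := Finset.exists_max_image
    (Finset.univ.filter fun Z : Finset V => Y ⊆ Z ∧ ord θ G Zᶜ = Z.card) Finset.card
    ⟨Y, by simp [hY]⟩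
  obtain ⟨hYZ, hord⟩ := (Finset.mem_filter.1 hZ).2
  have hle : ∀ w ∈ Zᶜ, ord θ G (Zᶜ.erase w) ≤ ord θ G Zᶜ := by
    intro w hw
    by_contra! hlt
    have h1 := ord_erase_le_ord_add_one (θ := θ) (G := G) hw
    have h2 := Finset.card_insert_of_notMem (Finset.mem_compl.1 hw)
    have h3 := hmax (insert w Z) (Finset.mem_filter.2 ⟨Finset.mem_univ _,
      hYZ.trans (Finset.subset_insert w Z), by rw [Finset.compl_insert]; omega⟩)
    omega
  refine hbase.2 (Z : Set V) ?_ u v (hYZ hu) (hYZ hv)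
  classical
  have hcount : numCritComponents θ (deleteSet G (Z : Set V)) = ord θ G Zᶜ := by
    rw [numCritComponents_eq_ord, ← mult_eq_ord_univ, mult_deleteSet]
    intro w
    rw [← mult_deleteVert, ← mult_eq_ord_univ, mult_deleteSet_deleteVert, mult_deleteSet]
    exact hle w (Finset.mem_compl.2 w.2)
  rw [IsBarrier, hcount, hbase.1.1, Set.ncard_coe_finset, hord, zero_add]

lemma ord_erase_erase_of_superPositive (hG : IsSuperPositive θ G) {v w : V} (hvw : v ≠ w) :
    ord θ G ((Finset.univ.erase v).erase w) = 0 ∨ ord θ G ((Finset.univ.erase v).erase w) = 2 := by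
  have h0 : ord θ G Finset.univ = 0 := by rw [← mult_eq_ord_univ, hG.1]
  have h1 : ∀ x, ord θ G (Finset.univ.erase x) = 1 := fun x => by rw [← mult_deleteVert, hG.2]
  have hw : w ∈ Finset.univ.erase v := Finset.mem_erase.2 ⟨hvw.symm, Finset.mem_univ w⟩
  have h2 := ord_erase_le_ord_add_one (θ := θ) (G := G) hw
  have hne : ord θ G ((Finset.univ.erase v).erase w) ≠ 1 := by
    intro h
    have h3 := even_of_lt_left (θ := θ) (G := G) (Finset.mem_univ v) (Finset.mem_univ w) hvw
      (by rw [h0, h1, h1, h]; norm_num)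
    rw [h0, h] at h3
    exact absurd h3 (by decide)
  have := h1 v
  omega

lemma positiveSet_deleteVert_eq_empty (hconn : G.Connected) (hbase : IsBase θ G) (v : V) :
    positiveSet θ (deleteVert G v) = ∅ := by
  have h1 : ∀ x, ord θ G (Finset.univ.erase x) = 1 := fun x => by
    rw [← mult_deleteVert, hbase.1.2]
  rw [Set.eq_empty_iff_forall_notMem]
  rintro w ⟨hpos, hspec⟩
  rw [IsPositive, mult_deleteVert_deleteVert, mult_deleteVert, h1] at hpos
  have hw : (w : V) ≠ v ∧ ord θ G ((Finset.univ.erase v).erase w) = 2 ∧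
      ∀ e, e ≠ v → G.Adj w e → ord θ G ((Finset.univ.erase v).erase e) ≠ 0 := by
    refine ⟨w.2, hpos, fun e hev hadj he => hspec ⟨?_, ⟨e, hev⟩, hadj, ?_⟩⟩
    · rw [IsEssential, mult_deleteVert_deleteVert, mult_deleteVert, h1]
      omega
    · rw [IsEssential, mult_deleteVert_deleteVert, mult_deleteVert, h1, he]
  have key : ∀ a b, (a ≠ v ∧ ord θ G ((Finset.univ.erase v).erase a) = 2 ∧
      ∀ e, e ≠ v → G.Adj a e → ord θ G ((Finset.univ.erase v).erase e) ≠ 0) → G.Adj a b →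
      (b ≠ v ∧ ord θ G ((Finset.univ.erase v).erase b) = 2 ∧
        ∀ e, e ≠ v → G.Adj b e → ord θ G ((Finset.univ.erase v).erase e) ≠ 0) := by
    rintro a b ⟨hav, ha, hae⟩ hab
    have hbv : b ≠ v := by
      rintro rfl
      refine not_adj_of_extreme hbase (Y := {a, b}) ?_ (by simp) (by simp) hab
      rw [Finset.compl_insert, Finset.compl_singleton, Finset.card_pair hav, ha]
    have hb := (ord_erase_erase_of_superPositive hbase.1 hbv.symm).resolve_left (hae b hbv hab)
    refine ⟨hbv, hb, fun e hev hbe he => ?_⟩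
    have mem : ∀ {x}, x ≠ v → x ∈ Finset.univ.erase v := fun hx =>
      Finset.mem_erase.2 ⟨hx, Finset.mem_univ _⟩
    have h3 := ord_erase_erase_of_special (θ := θ) (mem hev) (mem hbv) (mem hav) hbe hab.ne'
      (by rw [he, h1]) (by rw [hb, h1]) (by rw [ha, h1])
    refine not_adj_of_extreme hbase (Y := {a, b, v}) ?_ (by simp) (by simp) hab
    rw [Finset.compl_insert, Finset.compl_insert, Finset.compl_singleton, h3, h1,
      Finset.card_eq_three.2 ⟨a, b, v, hab.ne, hav, hbv, rfl⟩]
  have hr := (SimpleGraph.reachable_iff_reflTransGen (w : V) v).1 (hconn.preconnected w v)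
  have hall : ∀ x, Relation.ReflTransGen G.Adj w x →
      (x ≠ v ∧ ord θ G ((Finset.univ.erase v).erase x) = 2 ∧
        ∀ e, e ≠ v → G.Adj x e → ord θ G ((Finset.univ.erase v).erase e) ≠ 0) := by
    intro x hx
    induction hx with
    | refl => exact hw
    | tail _ hxy ih => exact key _ _ ih hxy
  exact (hall v hr).1 rfl

end Main

/-- Every connected θ-base graph is θ-elementary. -/
theorem stmt_14 {V : Type*} [Fintype V] (θ : ℝ) (G : SimpleGraph V)
    (hconn : G.Connected) (hbase : IsBase θ G) :
    IsElementary θ G := by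
  classical
  exact ⟨hbase.1, positiveSet_deleteVert_eq_empty hconn hbase⟩

end MatchPoly
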